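/- Let S be a nonempty finite connected poset. (1) If S has at least two minimal elements, then there exist distinct minimal elements a ≠ a' of S such that the principal up-sets intersect: ↑a ∩ ↑a' ≠ ∅ (equivalently, ↑a ∩ ↑a' has a minimal element). (2) Dually, if S has at least two maximal elements, then there exist distinct maximal elements b ≠ b' of S with ↓b ∩ ↓b' ≠ ∅. -/

import Mathlib

open Classical Module

attribute [local instance] Classical.propDecidable
set_option linter.unusedVariables false
set_option maxHeartbeats 1000000

/-- A poset is connected if any two of its elements are linked by a finite sequence in
which consecutive elements are comparable. -/
def PosetConn (S : Type) [Preorder S] : Prop :=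
  ∀ a b : S, Relation.ReflTransGen (fun u v : S => u ≤ v ∨ v ≤ u) a b

/-- `x` is a minimal element of the poset `S`. -/
def IsMinElem {S : Type} [Preorder S] (x : S) : Prop := ∀ y : S, y ≤ x → y = x

/-- `x` is a maximal element of the poset `S`. -/
def IsMaxElem {S : Type} [Preorder S] (x : S) : Prop := ∀ y : S, x ≤ y → x = y

/-- In a finite poset every element lies above a minimal element. -/
theorem exists_isMinElem_le {S : Type} [PartialOrder S] [Finite S] (x : S) :
    ∃ m : S, m ≤ x ∧ IsMinElem m := by
  obtain ⟨m, hmx, hm⟩ := (Set.toFinite (Set.univ : Set S)).exists_le_minimal (Set.mem_univ x)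
  exact ⟨m, hmx, fun y hy => le_antisymm hy (hm.2 (Set.mem_univ y) hy)⟩

/-- In a finite connected poset with two distinct minimal elements, some two distinct minimal
elements have a common upper bound. -/
theorem PosetConn.exists_isMinElem_pair_le {S : Type} [PartialOrder S] [Finite S]
    (hconn : PosetConn S) (h : ∃ a b : S, a ≠ b ∧ IsMinElem a ∧ IsMinElem b) :
    ∃ a b : S, a ≠ b ∧ IsMinElem a ∧ IsMinElem b ∧ ∃ z : S, a ≤ z ∧ b ≤ z := by
  obtain ⟨a, b, hab, ha, hb⟩ := h
  by_contra hnone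
  have le_of_linked (x : S) (hx : Relation.ReflTransGen (fun u v : S => u ≤ v ∨ v ≤ u) a x) :
      a ≤ x := by
    induction hx with
    | refl => exact le_rfl
    | @tail u v _ huv hau =>
      rcases huv with huv | hvu
      · exact hau.trans huv
      · obtain ⟨m, hmv, hm⟩ := exists_isMinElem_le v
        have ham : a = m := by
          by_contra hne
          exact hnone ⟨a, m, hne, ha, hm, u, hau, hmv.trans hvu⟩
        exact ham ▸ hmv
  exact hab (hb a (le_of_linked b (hconn a b)))

/-- The order dual of a connected poset is connected. -/
theorem PosetConn.orderDual {S : Type} [PartialOrder S] (hconn : PosetConn S) :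
    PosetConn Sᵒᵈ :=
  fun a b => (hconn (OrderDual.ofDual a) (OrderDual.ofDual b)).lift OrderDual.toDual
    fun u v (huv : u ≤ v ∨ v ≤ u) => huv.symm

/-- Minimal elements of the order dual are the maximal elements. -/
theorem isMinElem_toDual_iff {S : Type} [PartialOrder S] {x : S} :
    IsMinElem (OrderDual.toDual x) ↔ IsMaxElem x :=
  ⟨fun h y hy => (h (OrderDual.toDual y) hy).symm, fun h y hy => (h (OrderDual.ofDual y) hy).symm⟩

/-- Let `S` be a nonempty finite connected poset.
(1) If `S` has at least two minimal elements, then there are two distinct minimal elements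
whose principal up-sets intersect.
(2) Dually, if `S` has at least two maximal elements, then there are two distinct maximal
elements whose principal down-sets intersect. -/
theorem exists_min_pair_with_common_upper (S : Type) [PartialOrder S] [Fintype S]
    [Nonempty S] (hconn : PosetConn S) :
    ((∃ a b : S, a ≠ b ∧ IsMinElem a ∧ IsMinElem b) →
      ∃ a b : S, a ≠ b ∧ IsMinElem a ∧ IsMinElem b ∧
        ({z : S | a ≤ z} ∩ {z : S | b ≤ z}).Nonempty) ∧
    ((∃ a b : S, a ≠ b ∧ IsMaxElem a ∧ IsMaxElem b) →
      ∃ a b : S, a ≠ b ∧ IsMaxElem a ∧ IsMaxElem b ∧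
        ({z : S | z ≤ a} ∩ {z : S | z ≤ b}).Nonempty) := by
  refine ⟨hconn.exists_isMinElem_pair_le, ?_⟩
  rintro ⟨a, b, hab, ha, hb⟩
  obtain ⟨c, d, hcd, hc, hd, z, hcz, hdz⟩ := hconn.orderDual.exists_isMinElem_pair_le
    ⟨OrderDual.toDual a, OrderDual.toDual b, hab, isMinElem_toDual_iff.2 ha,
      isMinElem_toDual_iff.2 hb⟩
  exact ⟨OrderDual.ofDual c, OrderDual.ofDual d, hcd, isMinElem_toDual_iff.1 hc,
    isMinElem_toDual_iff.1 hd, OrderDual.ofDual z, hcz, hdz⟩
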